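/- Let R be a commutative ℝ-algebra, s a natural number, and let a : Fin s → Fin s → ℝ and b : Fin s → ℝ satisfy the symplectic condition b i * a i j + b j * a j i - b i * b j = 0 for all i, j. Fix Δt ∈ ℝ and C ∈ ℝ. Let φ : ℕ → R and q : ℕ → R be sequences such that for every n there exists k : Fin s → R with: φᵢⁿ = φ(n) + Δt • Σⱼ a i j • kⱼ, lᵢⁿ = 2 φᵢⁿ kᵢ, φ(n+1) = φ(n) + Δt • Σᵢ b i • kᵢ, and q(n+1) = q(n) + Δt • Σᵢ b i • lᵢⁿ. If the consistent initial condition q(0) = (φ(0))² - 1 - C • 1 holds, then q(n) = (φ(n))² - 1 - C • 1 for every n ∈ ℕ. -/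

import Mathlib

open Finset

theorem sq_sum_smul_of_symplectic {S R ι : Type*} [CommRing S] [CommRing R] [Algebra S R]
    [Fintype ι] (a : ι → ι → S) (b : ι → S)
    (hsym : ∀ i j, b i * a i j + b j * a j i - b i * b j = 0) (k : ι → R) :
    (∑ i, b i • k i) ^ 2 = 2 * ∑ i, b i • ((∑ j, a i j • k j) * k i) := by
  have hdouble : ∑ i, b i • ((∑ j, a i j • k j) * k i) =
      ∑ i, ∑ j, (b i * a i j) • (k i * k j) := by
    refine sum_congr rfl fun i _ => ?_
    rw [sum_mul, smul_sum]
    refine sum_congr rfl fun j _ => ?_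
    rw [smul_mul_assoc, smul_smul, mul_comm (k j)]
  have hswap : ∑ i, ∑ j, (b i * a i j) • (k i * k j) =
      ∑ i, ∑ j, (b j * a j i) • (k i * k j) := by
    rw [sum_comm]
    refine sum_congr rfl fun i _ => sum_congr rfl fun j _ => ?_
    rw [mul_comm (k j)]
  rw [hdouble, two_mul]
  nth_rw 2 [hswap]
  rw [sq, sum_mul_sum, ← sum_add_distrib]
  refine sum_congr rfl fun i _ => ?_
  rw [← sum_add_distrib]
  refine sum_congr rfl fun j _ => ?_
  rw [smul_mul_smul_comm, ← add_smul, sub_eq_zero.mp (hsym i j)]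

/-- Lemma 2 of the paper: the s-stage Runge–Kutta IEQ scheme with symplectic
coefficients exactly preserves the relation `q = φ² - 1 - C` at every time
step, provided the initial data are consistent. -/
theorem ieq_rk_consistency_propagation
    {R : Type*} [CommRing R] [Algebra ℝ R] (s : ℕ)
    (a : Fin s → Fin s → ℝ) (b : Fin s → ℝ)
    (hsym : ∀ i j, b i * a i j + b j * a j i - b i * b j = 0)
    (Δt C : ℝ) (φ q : ℕ → R)
    (hstep : ∀ n : ℕ, ∃ k : Fin s → R,
      φ (n + 1) = φ n + Δt • ∑ i, b i • k i ∧
      q (n + 1) = q n + Δt • ∑ i, b i •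
        (2 * (φ n + Δt • ∑ j, a i j • k j) * k i))
    (hinit : q 0 = (φ 0) ^ 2 - 1 - C • (1 : R)) :
    ∀ n : ℕ, q n = (φ n) ^ 2 - 1 - C • (1 : R) := by
  intro n
  induction n with
  | zero => exact hinit
  | succ n ih =>
    obtain ⟨k, hφ, hq⟩ := hstep n
    have hsum : ∑ i, b i • (2 * (φ n + Δt • ∑ j, a i j • k j) * k i) =
        2 * φ n * ∑ i, b i • k i + Δt • (∑ i, b i • k i) ^ 2 := by
      rw [sq_sum_smul_of_symplectic a b hsym k, mul_sum, mul_sum, smul_sum, ← sum_add_distrib]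
      refine sum_congr rfl fun i _ => ?_
      simp only [Algebra.smul_def]
      ring
    rw [hq, hφ, ih, hsum]
    simp only [Algebra.smul_def]
    ring
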